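/- Assume t := ⌊(d−1)/2⌋ and ε ≤ t (the number of errors is at most half the designed distance). Let (u,v) ∈ M_0(S_y) be nonzero with lm(u,v) ≤ lm(ω,σ). Then there exists c ∈ F* such that (u,v) = c·(ω,σ). Consequently, (ω,σ) is the unique minimal element (u,v) of M_0(S_y) with v(0) = 1. -/

import Mathlib

open Polynomial

noncomputable def synd {F : Type*} [Field F] (n d : ℕ) (ta : Fin n → F) (lam : F)
    (y : Fin n → F) : F[X] :=
  ∑ j ∈ Finset.range (d - 1), C (∑ i : Fin n, ta i * y i * lam ^ ((i : ℕ) * j)) * X ^ j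

/-- The module `M_r(S; α; β)` of the paper: pairs `(u,v)` with `u ≡ S v (mod X^{d-1})`,
`v(α_j⁻¹) = 0` and `β_j a_j v'(α_j⁻¹) = -α_j u(α_j⁻¹)` for all `j`. -/
def Mmod {F : Type*} [Field F] (d : ℕ) (S : F[X]) {r : ℕ} (α β a : Fin r → F) :
    Set (F[X] × F[X]) :=
  { uv | (X : F[X]) ^ (d - 1) ∣ uv.1 - S * uv.2 ∧
      ∀ j : Fin r, uv.2.eval (α j)⁻¹ = 0 ∧
        β j * a j * ((derivative uv.2).eval (α j)⁻¹) = -(α j * uv.1.eval (α j)⁻¹) }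

/-- The error-locator polynomial `σ(X) = ∏ᵢ (1 - αᵢ X)`. -/
noncomputable def elp {F : Type*} [Field F] {ε : ℕ} (α' : Fin ε → F) : F[X] :=
  ∏ i : Fin ε, (1 - C (α' i) * X)

/-- The error-evaluator polynomial `ω(X) = Σᵢ cᵢ ∏_{j≠i} (1 - αⱼ X)` (with `cᵢ = βᵢ aᵢ`). -/
noncomputable def eep {F : Type*} [Field F] {ε : ℕ} (α' c : Fin ε → F) : F[X] :=
  ∑ i : Fin ε, C (c i) * ∏ j ∈ Finset.univ.erase i, (1 - C (α' j) * X)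

/-- Degree of a polynomial, as an element of `WithBot ℤ` (so `deg 0 = ⊥ = -∞`). -/
noncomputable def degZ {F : Type*} [Field F] (p : F[X]) : WithBot ℤ :=
  p.degree.map (fun k : ℕ => (k : ℤ))

/-- The monomial ordering `<_w` on monomials of `F[X]²`: `Sum.inl i` stands for the
monomial `(X^i, 0)` and `Sum.inr j` for `(0, X^j)`. -/
def monLt (w : ℤ) : ℕ ⊕ ℕ → ℕ ⊕ ℕ → Prop
  | Sum.inl i, Sum.inl j => i < j
  | Sum.inr i, Sum.inr j => i < j
  | Sum.inl i, Sum.inr j => (i : ℤ) ≤ (j : ℤ) + w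
  | Sum.inr i, Sum.inl j => (i : ℤ) + w < (j : ℤ)

def monLe (w : ℤ) (m m' : ℕ ⊕ ℕ) : Prop := monLt w m m' ∨ m = m'

/-- The `<_w`-leading monomial of a (nonzero) pair `(u,v) ∈ F[X]²`:
`(X^{deg u}, 0)` if `deg u ≥ deg v + w + 1`, and `(0, X^{deg v})` otherwise. -/
noncomputable def lm {F : Type*} [Field F] (w : ℤ) (u v : F[X]) : ℕ ⊕ ℕ :=
  if degZ v + (w : WithBot ℤ) + 1 ≤ degZ u then Sum.inl u.natDegree else Sum.inr v.natDegree

theorem mem_Mmod_zero {F : Type*} [Field F] {d : ℕ} {S u v : F[X]} {α β a : Fin 0 → F} :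
    (u, v) ∈ Mmod d S α β a ↔ (X : F[X]) ^ (d - 1) ∣ u - S * v := by
  simp [Mmod]

theorem synd_add {F : Type*} [Field F] (n d : ℕ) (ta : Fin n → F) (lam : F) (x e : Fin n → F) :
    synd n d ta lam (x + e) = synd n d ta lam x + synd n d ta lam e := by
  simp only [synd, ← Finset.sum_add_distrib, ← add_mul, ← C_add, Pi.add_apply, mul_add]

/-- The syndrome of a word supported on the range of `loc`, as a sum of truncated geometric
series. -/
theorem synd_eq_sum_of_support {F : Type*} [Field F] {n ε : ℕ} (d : ℕ) (ta : Fin n → F) (lam : F)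
    (e : Fin n → F) (loc : Fin ε → Fin n) (hloc : Function.Injective loc)
    (hsupp : ∀ i, e i ≠ 0 → ∃ k, loc k = i) :
    synd n d ta lam e = ∑ k, C (e (loc k) * ta (loc k)) *
      ∑ j ∈ Finset.range (d - 1), (C (lam ^ (loc k : ℕ)) * X) ^ j := by
  simp only [Finset.mul_sum]
  rw [Finset.sum_comm]
  refine Finset.sum_congr rfl fun j _ => ?_
  have h : ∑ k, e (loc k) * ta (loc k) * lam ^ ((loc k : ℕ) * j) =
      ∑ i : Fin n, ta i * e i * lam ^ ((i : ℕ) * j) := by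
    refine Fintype.sum_of_injective loc hloc _ _ (fun i hi => ?_) fun k => by ring
    have : e i = 0 := by
      by_contra h0
      exact hi (hsupp i h0)
    simp [this]
  rw [← h, map_sum, Finset.sum_mul]
  refine Finset.sum_congr rfl fun k _ => ?_
  simp only [map_mul, map_pow, mul_pow, pow_mul]
  ring

/-- The key equation `ω ≡ S σ (mod X^m)`. -/
theorem X_pow_dvd_eep_sub {F : Type*} [Field F] {ε : ℕ} (m : ℕ) (α c : Fin ε → F) :
    (X : F[X]) ^ m ∣ eep α c -
      (∑ k, C (c k) * ∑ j ∈ Finset.range m, (C (α k) * X) ^ j) * elp α := by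
  rw [eep, Finset.sum_mul, ← Finset.sum_sub_distrib]
  refine Finset.dvd_sum fun k _ => ?_
  rw [elp, ← Finset.mul_prod_erase Finset.univ _ (Finset.mem_univ k)]
  have h := mul_neg_geom_sum (C (α k) * X) m
  refine ⟨C (c k) * C (α k) ^ m * ∏ j ∈ Finset.univ.erase k, (1 - C (α j) * X), ?_⟩
  rw [mul_pow] at h
  linear_combination
    (-C (c k) * ∏ j ∈ Finset.univ.erase k, (1 - C (α j) * X)) * h

theorem degree_one_sub_C_mul_X {F : Type*} [Field F] {a : F} (ha : a ≠ 0) :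
    (1 - C a * X : F[X]).degree = 1 := by
  have h : (1 - C a * X : F[X]) = C (-a) * X + C 1 := by
    simp only [map_neg, map_one]
    ring
  rw [h, degree_linear (neg_ne_zero.mpr ha)]

theorem degree_elp {F : Type*} [Field F] {ε : ℕ} {α : Fin ε → F} (hα : ∀ k, α k ≠ 0) :
    (elp α).degree = ε := by
  simp [elp, degree_prod, degree_one_sub_C_mul_X (hα _)]

theorem degree_eep_lt {F : Type*} [Field F] {ε : ℕ} {α : Fin ε → F} (hα : ∀ k, α k ≠ 0)
    (c : Fin ε → F) : (eep α c).degree < ε := by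
  rw [← mem_degreeLT]
  refine Submodule.sum_mem _ fun k _ => mem_degreeLT.mpr ?_
  have hε : 0 < ε := k.pos
  rw [← smul_eq_C_mul]
  refine (degree_smul_le _ _).trans_lt ?_
  simp only [degree_prod, degree_one_sub_C_mul_X (hα _), Finset.sum_const,
    Finset.card_erase_of_mem (Finset.mem_univ k), Finset.card_univ, Fintype.card_fin]
  rw [nsmul_one]
  exact_mod_cast Nat.sub_lt hε one_pos

theorem isCoprime_one_sub_C_mul_X {F : Type*} [Field F] {a : F} (ha : a ≠ 0) {p : F[X]}
    (hp : p.eval a⁻¹ ≠ 0) : IsCoprime (1 - C a * X) p := by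
  refine (irreducible_of_degree_eq_one (degree_one_sub_C_mul_X ha)).coprime_iff_not_dvd.mpr ?_
  rintro ⟨q, rfl⟩
  simp [ha] at hp

theorem isCoprime_elp_eep {F : Type*} [Field F] {ε : ℕ} {α c : Fin ε → F} (hα : ∀ k, α k ≠ 0)
    (hinj : Function.Injective α) (hc : ∀ k, c k ≠ 0) : IsCoprime (elp α) (eep α c) := by
  refine IsCoprime.prod_left fun k _ => isCoprime_one_sub_C_mul_X (hα k) ?_
  rw [eep, eval_finsetSum, Finset.sum_eq_single k]
  · simp only [eval_mul, eval_C, eval_prod, eval_sub, eval_one, eval_X]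
    refine mul_ne_zero (hc k) (Finset.prod_ne_zero_iff.mpr fun j hj h => ?_)
    refine Finset.ne_of_mem_erase hj (hinj ?_)
    rwa [sub_eq_zero, eq_comm, mul_inv_eq_one₀ (hα k)] at h
  · intro i _ hik
    rw [eval_mul, eval_prod, Finset.prod_eq_zero (i := k) (by simp [hik.symm]) (by simp [hα k]),
      mul_zero]
  · simp

/-- Powers of a primitive element of a finite field with exponents below `q - 1` are nonzero
and distinct. -/
theorem primitive_pow_ne_zero_and_injective {F : Type*} [Field F] [Fintype F] {n : ℕ}
    (hn : n = Fintype.card F - 1) {lam : F} (hlam : ∀ z : F, z ≠ 0 → ∃ k : ℕ, z = lam ^ k) :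
    (∀ i : Fin n, lam ^ (i : ℕ) ≠ 0) ∧ Function.Injective fun i : Fin n => lam ^ (i : ℕ) := by
  classical
  rw [← Fintype.card_units] at hn
  rcases eq_or_ne lam 0 with rfl | h0
  · have hone : ∀ z : F, z ≠ 0 → z = 1 := by
      intro z hz
      obtain ⟨k, rfl⟩ := hlam z hz
      rcases eq_or_ne k 0 with rfl | hk
      · simp
      · exact absurd (zero_pow hk) hz
    have hn1 : n ≤ 1 := by
      rw [hn, Fintype.card_le_one_iff]
      intro a b
      exact Units.ext ((hone a a.ne_zero).trans (hone b b.ne_zero).symm)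
    have hi : ∀ i : Fin n, (i : ℕ) = 0 := fun i => by omega
    exact ⟨fun i => by simp [hi i], fun i j _ => Fin.ext ((hi i).trans (hi j).symm)⟩
  · refine ⟨fun i => pow_ne_zero _ h0, fun i j hij => Fin.ext ?_⟩
    have ho : orderOf (Units.mk0 lam h0) = n := by
      rw [hn, ← Nat.card_eq_fintype_card]
      refine orderOf_eq_card_of_forall_mem_zpowers fun z => ?_
      obtain ⟨k, hk⟩ := hlam z z.ne_zero
      exact ⟨k, Units.ext (by simp [hk])⟩
    exact pow_injOn_Iio_orderOf (x := Units.mk0 lam h0) (by simp [ho]) (by simp [ho])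
      (Units.ext (by simpa using hij))

theorem degZ_le_degZ {F : Type*} [Field F] {p q : F[X]} :
    degZ p + ((-1 : ℤ) : WithBot ℤ) + 1 ≤ degZ q ↔ p.degree ≤ q.degree := by
  have h : degZ p + ((-1 : ℤ) : WithBot ℤ) + 1 = degZ p := by
    rw [add_assoc]
    exact add_zero _
  rw [h, degZ, degZ]
  exact WithBot.map_le_iff _ Nat.cast_le

theorem lm_neg_one {F : Type*} [Field F] (u v : F[X]) :
    lm (-1) u v = if v.degree ≤ u.degree then Sum.inl u.natDegree else Sum.inr v.natDegree := by
  rw [lm]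
  exact if_congr degZ_le_degZ rfl rfl

theorem degree_lt_and_le_of_monLe {F : Type*} [Field F] {u v : F[X]} {k : ℕ}
    (h : monLe (-1) (lm (-1) u v) (Sum.inr k)) : u.degree < k ∧ v.degree ≤ k := by
  rw [lm_neg_one] at h
  split_ifs at h with hle
  · have hlt : u.natDegree < k := by
      rcases h with h | h
      · simp only [monLt] at h
        omega
      · cases h
    have hu : u.degree < k := degree_le_natDegree.trans_lt (by exact_mod_cast hlt)
    exact ⟨hu, hle.trans hu.le⟩
  · have hk : v.natDegree ≤ k := by
      rcases h with h | h
      · exact le_of_lt h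
      · exact (Sum.inr.inj h).le
    have hv : v.degree ≤ k := degree_le_natDegree.trans (by exact_mod_cast hk)
    exact ⟨(not_le.mp hle).trans_le hv, hv⟩

/-- A solution of `u ≡ S v (mod X^m)` is proportional to a coprime solution `(ω, σ)` as soon as
the degrees satisfy `deg ω, deg u < k`, `deg v ≤ k = deg σ` and `2 k ≤ m`. -/
theorem eq_C_mul_of_X_pow_dvd {F : Type*} [Field F] {S ω σ u v : F[X]} {k m : ℕ}
    (hm : 2 * k ≤ m) (hcop : IsCoprime σ ω) (hσ : σ.degree = k) (hω : ω.degree < k)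
    (hu : u.degree < k) (hv : v.degree ≤ k) (hne : (u, v) ≠ (0, 0))
    (hωσ : X ^ m ∣ ω - S * σ) (huv : X ^ m ∣ u - S * v) :
    ∃ c : F, c ≠ 0 ∧ u = C c * ω ∧ v = C c * σ := by
  have hσ0 : σ ≠ 0 := fun h => by simp [h] at hσ
  have hlt : (u * σ - v * ω).degree < (X ^ m : F[X]).degree := by
    have hm' : ((k : WithBot ℕ) + k) ≤ m := by
      rw [two_mul] at hm
      exact_mod_cast hm
    rw [degree_X_pow]
    refine (degree_sub_le _ _).trans_lt (max_lt ?_ ?_) <;> rw [degree_mul]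
    · rw [hσ]
      exact (WithBot.add_lt_add_right (WithBot.coe_ne_bot (a := k)) hu).trans_le hm'
    · exact ((add_le_add_left hv _).trans_lt
        (WithBot.add_lt_add_left (WithBot.coe_ne_bot (a := k)) hω)).trans_le hm'
  have hdvd : X ^ m ∣ u * σ - v * ω := by
    have := (huv.mul_right σ).sub (hωσ.mul_right v)
    convert this using 1
    ring
  have heq : u * σ = v * ω := sub_eq_zero.mp (eq_zero_of_dvd_of_degree_lt hdvd hlt)
  obtain ⟨q, rfl⟩ : σ ∣ v := hcop.dvd_of_dvd_mul_right ⟨u, by rw [← heq, mul_comm]⟩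
  have huq : u = q * ω := mul_right_cancel₀ hσ0 (by rw [heq]; ring)
  have hq0 : q ≠ 0 := by
    rintro rfl
    simp [huq] at hne
  have hq : q.natDegree = 0 := by
    rw [degree_mul, hσ, degree_eq_natDegree hq0] at hv
    have : k + q.natDegree ≤ k := by exact_mod_cast hv
    omega
  rw [eq_C_of_natDegree_eq_zero hq] at huq hq0 ⊢
  exact ⟨_, C_ne_zero.mp hq0, huq, mul_comm _ _⟩

/-- if the number of errors `ε` is at most `t = ⌊(d-1)/2⌋`, then every nonzero
`(u,v) ∈ M₀(S_y)` with `lm(u,v) ≤ lm(ω,σ)` is a nonzero constant multiple of `(ω,σ)`;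
consequently `(ω,σ)` is the unique minimal element `(u,v)` of `M₀(S_y)` with `v(0) = 1`. -/
theorem stmt6 {F : Type*} [Field F] [Fintype F]
    (n d : ℕ) (hn : n = Fintype.card F - 1) (hd : 2 ≤ d)
    (lam : F) (hlam : ∀ z : F, z ≠ 0 → ∃ k : ℕ, z = lam ^ k)
    (ta : Fin n → F) (hta : ∀ i, ta i ≠ 0)
    (x e y : Fin n → F) (hy : y = x + e)
    (hx : synd n d ta lam x = 0)
    (ε : ℕ) (loc : Fin ε → Fin n) (hloc : Function.Injective loc)
    (hsupp : ∀ i : Fin n, e i ≠ 0 ↔ ∃ k, loc k = i)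
    (hε : ε ≤ (d - 1) / 2) :
    (∀ u v : F[X],
      (u, v) ∈ Mmod d (synd n d ta lam y)
          (Fin.elim0 : Fin 0 → F) (Fin.elim0 : Fin 0 → F) (Fin.elim0 : Fin 0 → F) →
      (u, v) ≠ (0, 0) →
      monLe (-1) (lm (-1) u v)
        (lm (-1) (eep (fun k => lam ^ ((loc k : ℕ))) (fun k => e (loc k) * ta (loc k)))
          (elp (fun k => lam ^ ((loc k : ℕ))))) →
      ∃ c : F, c ≠ 0 ∧
        u = C c * eep (fun k => lam ^ ((loc k : ℕ))) (fun k => e (loc k) * ta (loc k)) ∧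
        v = C c * elp (fun k => lam ^ ((loc k : ℕ)))) ∧
    ∀ u v : F[X],
      (u, v) ∈ Mmod d (synd n d ta lam y)
          (Fin.elim0 : Fin 0 → F) (Fin.elim0 : Fin 0 → F) (Fin.elim0 : Fin 0 → F) →
      (u, v) ≠ (0, 0) → v.eval 0 = 1 →
      (∀ u' v' : F[X],
        (u', v') ∈ Mmod d (synd n d ta lam y)
            (Fin.elim0 : Fin 0 → F) (Fin.elim0 : Fin 0 → F) (Fin.elim0 : Fin 0 → F) →
        (u', v') ≠ (0, 0) → monLe (-1) (lm (-1) u v) (lm (-1) u' v')) →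
      u = eep (fun k => lam ^ ((loc k : ℕ))) (fun k => e (loc k) * ta (loc k)) ∧
      v = elp (fun k => lam ^ ((loc k : ℕ))) := by
  obtain ⟨hpow, hpinj⟩ := primitive_pow_ne_zero_and_injective hn hlam
  set α : Fin ε → F := fun k => lam ^ (loc k : ℕ)
  set c : Fin ε → F := fun k => e (loc k) * ta (loc k)
  have hα : ∀ k, α k ≠ 0 := fun k => hpow (loc k)
  have hc : ∀ k, c k ≠ 0 := fun k => mul_ne_zero ((hsupp _).mpr ⟨k, rfl⟩) (hta _)
  have hσ := degree_elp hα
  have hω := degree_eep_lt hα c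
  have hkey : (X : F[X]) ^ (d - 1) ∣ eep α c - synd n d ta lam y * elp α := by
    rw [hy, synd_add, hx, zero_add,
      synd_eq_sum_of_support d ta lam e loc hloc fun i => (hsupp i).mp]
    exact X_pow_dvd_eep_sub (d - 1) α c
  have hlm : lm (-1) (eep α c) (elp α) = Sum.inr ε := by
    rw [lm_neg_one, hσ, if_neg (not_le.mpr hω), natDegree_eq_of_degree_eq_some hσ]
  have huniq : ∀ u v : F[X], (X : F[X]) ^ (d - 1) ∣ u - synd n d ta lam y * v →
      (u, v) ≠ (0, 0) → monLe (-1) (lm (-1) u v) (lm (-1) (eep α c) (elp α)) →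
      ∃ b : F, b ≠ 0 ∧ u = C b * eep α c ∧ v = C b * elp α := by
    intro u v huv hne hle
    rw [hlm] at hle
    obtain ⟨hu, hv⟩ := degree_lt_and_le_of_monLe hle
    exact eq_C_mul_of_X_pow_dvd (by omega) (isCoprime_elp_eep hα (hpinj.comp hloc) hc)
      hσ hω hu hv hne hkey huv
  simp only [mem_Mmod_zero]
  refine ⟨huniq, fun u v huv hne hv0 hmin => ?_⟩
  have hne' : (eep α c, elp α) ≠ (0, 0) := by
    intro h
    simp [(Prod.mk.inj h).2] at hσ
  obtain ⟨b, -, rfl, rfl⟩ := huniq u v huv hne (hmin _ _ hkey hne')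
  obtain rfl : b = 1 := by simpa [elp, eval_prod] using hv0
  simp
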